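/- Let σ_w > 0, f(γ) = (1/π)(√(1−γ²) − γ·arccos γ), f̂(γ) = γ + f(γ). For γ_0 ∈ [−1,1], let t ↦ c_t(γ_0) be the unique solution on [0,1] of ċ_t = (σ_w²/2)·f(c_t) with c_0 = γ_0, and for each integer L ≥ 1 define C_{l|L}(γ_0) for l ∈ {0,…,L} by C_{0|L}(γ_0) = γ_0 and C_{l|L}(γ_0) = (1 + σ_w²/(2L))^{−1}·( C_{l−1|L}(γ_0) + (σ_w²/(2L))·f̂(C_{l−1|L}(γ_0)) ). Then lim_{L→∞} sup_{l ∈ {0,…,L}} sup_{γ_0 ∈ [−1,1]} | C_{l|L}(γ_0) − c_{l/L}(γ_0) | = 0. -/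

import Mathlib

/-- The "residual" part of the ReLU dual kernel function. -/
noncomputable def resf (γ : ℝ) : ℝ :=
  (1 / Real.pi) * (Real.sqrt (1 - γ ^ 2) - γ * Real.arccos γ)

/-- The ReLU dual kernel function `f̂ = γ + f(γ)`. -/
noncomputable def fhat (γ : ℝ) : ℝ := γ + resf γ

theorem continuous_resf : Continuous resf := by
  unfold resf
  have := Real.continuous_arccos
  fun_prop

theorem hasDerivAt_resf {x : ℝ} (hx : x ∈ Set.Ioo (-1 : ℝ) 1) :
    HasDerivAt resf (-(Real.arccos x / Real.pi)) x := by
  have hpos : 0 < 1 - x ^ 2 := by nlinarith [hx.1, hx.2]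
  have hsq : HasDerivAt (fun y : ℝ => 1 - y ^ 2) (-(2 * x)) x := by
    simpa using (hasDerivAt_pow 2 x).const_sub 1
  have harccos := (hasDerivAt_id' x).fun_mul (Real.hasDerivAt_arccos hx.1.ne' hx.2.ne)
  refine (((hsq.sqrt hpos.ne').fun_sub harccos).const_mul (1 / Real.pi)).congr_deriv ?_
  have := Real.sqrt_pos.2 hpos
  field_simp
  ring

theorem resf_one : resf 1 = 0 := by simp [resf]

theorem resf_neg_one : resf (-1) = 1 := by
  simp [resf, Real.pi_ne_zero]

theorem antitoneOn_resf : AntitoneOn resf (Set.Icc (-1) 1) := by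
  refine antitoneOn_of_hasDerivWithinAt_nonpos (f' := fun x => -(Real.arccos x / Real.pi))
    (convex_Icc _ _) continuous_resf.continuousOn ?_ ?_
  · intro x hx
    rw [interior_Icc] at hx
    exact (hasDerivAt_resf hx).hasDerivWithinAt
  · intro x _
    exact neg_nonpos.2 (div_nonneg (Real.arccos_nonneg x) Real.pi_pos.le)

theorem monotoneOn_fhat : MonotoneOn fhat (Set.Icc (-1) 1) := by
  refine monotoneOn_of_hasDerivWithinAt_nonneg (f' := fun x => 1 + -(Real.arccos x / Real.pi))
    (convex_Icc _ _) (continuous_id.add continuous_resf).continuousOn ?_ ?_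
  · intro x hx
    rw [interior_Icc] at hx
    exact ((hasDerivAt_id' x).add (hasDerivAt_resf hx)).hasDerivWithinAt
  · intro x _
    have := (div_le_one Real.pi_pos).2 (Real.arccos_le_pi x)
    linarith

theorem resf_mem_Icc {x : ℝ} (hx : x ∈ Set.Icc (-1 : ℝ) 1) : resf x ∈ Set.Icc (0 : ℝ) 1 := by
  constructor
  · simpa [resf_one] using antitoneOn_resf hx (by norm_num) hx.2
  · simpa [resf_neg_one] using antitoneOn_resf (by norm_num) hx hx.1

theorem abs_resf_sub_le {x y : ℝ} (hx : x ∈ Set.Icc (-1 : ℝ) 1) (hy : y ∈ Set.Icc (-1 : ℝ) 1) :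
    |resf x - resf y| ≤ |x - y| := by
  wlog hxy : x ≤ y generalizing x y
  · rw [abs_sub_comm, abs_sub_comm x]
    exact this hy hx (le_of_not_ge hxy)
  have h₁ := antitoneOn_resf hx hy hxy
  have h₂ := monotoneOn_fhat hx hy hxy
  unfold fhat at h₂
  rw [abs_of_nonneg (by linarith), abs_of_nonpos (by linarith)]
  linarith

/-- An explicit Euler step of size at most one does not expand distances on `[-1, 1]`. -/
theorem abs_add_mul_resf_sub_le {η x y : ℝ} (hη₀ : 0 ≤ η) (hη₁ : η ≤ 1)
    (hx : x ∈ Set.Icc (-1 : ℝ) 1) (hy : y ∈ Set.Icc (-1 : ℝ) 1) :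
    |(x + η * resf x) - (y + η * resf y)| ≤ |x - y| := by
  wlog hxy : x ≤ y generalizing x y
  · rw [abs_sub_comm, abs_sub_comm x]
    exact this hy hx (le_of_not_ge hxy)
  have h₁ := antitoneOn_resf hx hy hxy
  have h₂ := monotoneOn_fhat hx hy hxy
  unfold fhat at h₂
  have h₃ : 0 ≤ η * (resf x - resf y) := mul_nonneg hη₀ (by linarith)
  have h₄ : η * (resf x - resf y) ≤ resf x - resf y :=
    mul_le_of_le_one_left (by linarith) hη₁
  rw [abs_of_nonpos (by linarith), abs_of_nonpos (by linarith)]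
  linarith

theorem add_mul_resf_mem_Icc {η x : ℝ} (hη₀ : 0 ≤ η) (hη₁ : η ≤ 1)
    (hx : x ∈ Set.Icc (-1 : ℝ) 1) : x + η * resf x ∈ Set.Icc (-1 : ℝ) 1 := by
  have hf := resf_mem_Icc hx
  have hmono := monotoneOn_fhat hx (by norm_num : (1 : ℝ) ∈ Set.Icc (-1 : ℝ) 1) hx.2
  simp only [fhat, resf_one] at hmono
  constructor
  · linarith [hx.1, mul_nonneg hη₀ hf.1]
  · linarith [mul_le_of_le_one_left hf.1 hη₁]

/-- Local truncation error of the explicit Euler scheme for `u' = k f(u)`. -/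
theorem abs_sub_euler_step_le {k t h : ℝ} (hk : 0 ≤ k) (hh : 0 ≤ h) {u : ℝ → ℝ}
    (hu : ∀ s ∈ Set.Icc t (t + h), u s ∈ Set.Icc (-1 : ℝ) 1)
    (hu' : ∀ s ∈ Set.Icc t (t + h),
      HasDerivWithinAt u (k * resf (u s)) (Set.Icc t (t + h)) s) :
    |u (t + h) - (u t + k * h * resf (u t))| ≤ (k * h) ^ 2 := by
  have ht : t ∈ Set.Icc t (t + h) := ⟨le_rfl, by linarith⟩
  have hth : t + h ∈ Set.Icc t (t + h) := ⟨by linarith, le_rfl⟩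
  have hlip : ∀ s ∈ Set.Icc t (t + h), |u s - u t| ≤ k * h := by
    intro s hs
    have := (convex_Icc t (t + h)).norm_image_sub_le_of_norm_hasDerivWithin_le (C := k) hu'
      (fun r hr => by
        have h₀ := resf_mem_Icc (hu r hr)
        rw [Real.norm_eq_abs, abs_of_nonneg (mul_nonneg hk h₀.1)]
        exact mul_le_of_le_one_right hk h₀.2) ht hs
    rw [Real.norm_eq_abs, Real.norm_eq_abs, abs_of_nonneg (sub_nonneg.2 hs.1)] at this
    exact this.trans (mul_le_mul_of_nonneg_left (by linarith [hs.2]) hk)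
  have := (convex_Icc t (t + h)).norm_image_sub_le_of_norm_hasDerivWithin_le
    (f := fun s => u s - s * (k * resf (u t))) (C := k * (k * h))
    (fun s hs => (hu' s hs).sub ((hasDerivWithinAt_id s _).mul_const (k * resf (u t))))
    (fun r hr => by
      rw [one_mul, ← mul_sub, Real.norm_eq_abs, abs_mul, abs_of_nonneg hk]
      exact mul_le_mul_of_nonneg_left
        ((abs_resf_sub_le (hu r hr) (hu t ht)).trans (hlip r hr)) hk) ht hth
  rw [Real.norm_eq_abs, Real.norm_eq_abs, add_sub_cancel_left, abs_of_nonneg hh] at this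
  calc _ = |u (t + h) - (t + h) * (k * resf (u t)) - (u t - t * (k * resf (u t)))| := by
        congr 1; ring
    _ ≤ _ := this
    _ = _ := by ring

/-- Global error of the scheme `x ↦ x + (k h / (1 + k h)) f(x)`. -/
theorem abs_scheme_sub_le {k h : ℝ} (hk : 0 ≤ k) (hh : 0 ≤ h) {u : ℝ → ℝ} {x : ℕ → ℝ} {n : ℕ}
    (hn : n * h ≤ 1)
    (hu : ∀ t ∈ Set.Icc (0 : ℝ) 1, u t ∈ Set.Icc (-1 : ℝ) 1)
    (hu' : ∀ t ∈ Set.Icc (0 : ℝ) 1,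
      HasDerivWithinAt u (k * resf (u t)) (Set.Icc (0 : ℝ) 1) t)
    (hx₀ : x 0 = u 0)
    (hx : ∀ l < n, x (l + 1) = x l + k * h / (1 + k * h) * resf (x l)) :
    ∀ l ≤ n, x l ∈ Set.Icc (-1 : ℝ) 1 ∧ |x l - u (l * h)| ≤ l * (2 * (k * h) ^ 2) := by
  have ha : 0 ≤ k * h := mul_nonneg hk hh
  have hη₀ : 0 ≤ k * h / (1 + k * h) := by positivity
  have hη₁ : k * h / (1 + k * h) ≤ 1 := (div_le_one (by linarith)).2 (by linarith)
  have hη₂ : |k * h / (1 + k * h) - k * h| ≤ (k * h) ^ 2 := by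
    have h₁ : k * h / (1 + k * h) - k * h = -((k * h) ^ 2 / (1 + k * h)) := by
      field_simp
      ring
    rw [h₁, abs_neg, abs_of_nonneg (by positivity)]
    exact div_le_self (sq_nonneg _) (by linarith)
  intro l
  induction l with
  | zero =>
    intro _
    simpa [hx₀] using hu 0 (by norm_num)
  | succ l ih =>
    intro hl
    obtain ⟨hmem, herr⟩ := ih (by omega)
    rw [hx l (by omega)]
    refine ⟨add_mul_resf_mem_Icc hη₀ hη₁ hmem, ?_⟩
    have hlh : (0 : ℝ) ≤ l * h := by positivity
    have hle : l * h + h ≤ 1 := by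
      have : ((l + 1 : ℕ) : ℝ) * h ≤ n * h := by gcongr
      push_cast at this
      linarith
    have hsub : Set.Icc (l * h) (l * h + h) ⊆ Set.Icc (0 : ℝ) 1 := Set.Icc_subset_Icc hlh hle
    have hul := hu (l * h) ⟨hlh, by linarith⟩
    have hlocal := abs_sub_euler_step_le hk hh (fun s hs => hu s (hsub hs))
      (fun s hs => (hu' s (hsub hs)).mono hsub)
    have hstep := (abs_add_mul_resf_sub_le hη₀ hη₁ hmem hul).trans herr
    have hf := resf_mem_Icc hul
    have hsize : |(k * h / (1 + k * h) - k * h) * resf (u (l * h))| ≤ (k * h) ^ 2 := by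
      rw [abs_mul, abs_of_nonneg hf.1]
      exact (mul_le_of_le_one_right (abs_nonneg _) hf.2).trans hη₂
    push_cast
    rw [add_one_mul (l : ℝ) h]
    rw [abs_le] at hlocal hstep hsize ⊢
    constructor <;> linarith [hlocal.1, hlocal.2, hstep.1, hstep.2, hsize.1, hsize.2]

/-- Uniform convergence (over layers and initial correlations) of the discrete
correlation recursion of a uniformly scaled Stable ResNet to the solution of the
continuous-depth ODE `ċ_t = (σ_w²/2) f(c_t)`. -/
theorem stmt9 (σw : ℝ) (hσw : 0 < σw)
    (c : ℝ → ℝ → ℝ)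
    (hc : ∀ γ0 ∈ Set.Icc (-1 : ℝ) 1,
      c 0 γ0 = γ0 ∧
      (∀ t ∈ Set.Icc (0 : ℝ) 1, c t γ0 ∈ Set.Icc (-1 : ℝ) 1) ∧
      (∀ t ∈ Set.Icc (0 : ℝ) 1,
        HasDerivWithinAt (fun s => c s γ0) (σw ^ 2 / 2 * resf (c t γ0))
          (Set.Icc (0 : ℝ) 1) t))
    (C : ℕ → ℕ → ℝ → ℝ)
    (hC0 : ∀ L : ℕ, 1 ≤ L → ∀ γ0, C L 0 γ0 = γ0)
    (hCrec : ∀ L : ℕ, 1 ≤ L → ∀ l : ℕ, 1 ≤ l → l ≤ L → ∀ γ0,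
      C L l γ0 = (1 + σw ^ 2 / (2 * (L : ℝ)))⁻¹ *
        (C L (l - 1) γ0 + σw ^ 2 / (2 * (L : ℝ)) * fhat (C L (l - 1) γ0))) :
    ∀ ε > (0 : ℝ), ∃ N : ℕ, 1 ≤ N ∧ ∀ L ≥ N, ∀ l ≤ L, ∀ γ0 ∈ Set.Icc (-1 : ℝ) 1,
      |C L l γ0 - c ((l : ℝ) / (L : ℝ)) γ0| < ε := by
  intro ε hε
  obtain ⟨N, hN⟩ := exists_nat_gt (2 * (σw ^ 2 / 2) ^ 2 / ε)
  refine ⟨N + 1, by omega, fun L hL l hl γ0 hγ0 => ?_⟩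
  obtain ⟨h0, hmem, hderiv⟩ := hc γ0 hγ0
  have hL₀ : (0 : ℝ) < L := by exact_mod_cast (by omega : 0 < L)
  have hlL : (l : ℝ) ≤ L := by exact_mod_cast hl
  have hNL : (N : ℝ) ≤ L := by exact_mod_cast (by omega : N ≤ L)
  have herr := (abs_scheme_sub_le (k := σw ^ 2 / 2) (h := (L : ℝ)⁻¹) (by positivity)
    (by positivity) (u := fun t => c t γ0) (x := fun l => C L l γ0) (n := L)
    (mul_inv_cancel₀ hL₀.ne').le hmem hderiv (by rw [hC0 L (by omega), h0])
    (fun m hm => by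
      rw [hCrec L (by omega) (m + 1) (by omega) (by omega), Nat.add_sub_cancel, fhat]
      field_simp
      ring) l hl).2
  simp only [← div_eq_mul_inv] at herr
  refine herr.trans_lt ?_
  calc (l : ℝ) * (2 * (σw ^ 2 / 2 / L) ^ 2) ≤ L * (2 * (σw ^ 2 / 2 / L) ^ 2) := by gcongr
    _ = 2 * (σw ^ 2 / 2) ^ 2 / L := by field_simp
    _ < ε := by
      rw [div_lt_iff₀ hε] at hN
      rw [div_lt_iff₀ hL₀]
      nlinarith
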